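/- Let S be a simple weighted transition system with finite output set Y ⊆ ℚ and nonempty behavior set. Suppose there exists a finite m ∈ ℕ such that every behavior α ∈ B^ω(S) satisfies Avg(β) ≥ VS(S) for every non-transient length-m infix β of α. Suppose additionally there exists a length-m word σ with σ^ω ∈ B^ω(S), and that every non-transient length-m infix β of every behavior α ∈ B^ω(S) satisfies LimAvg(β^ω) > VS(S) whenever β is not an infix of σ^ω. Then there exists a finite l such that the strongest l-complete abstraction S_l of S satisfies VS(S_l) = VS(S) = LimAvg(σ^ω), and every cycle of S_l whose output word c satisfies LimAvg(c^ω) = VS(S_l) satisfies c^ω = τ^ω for some cyclic permutation τ of σ. -/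

import Mathlib

structure TS (X : Type*) where
  init : Set X
  E : Set (X × X)
  H : X → ℚ

variable {X : Type*}

def TS.IsRun (S : TS X) (r : ℕ → X) : Prop :=
  r 0 ∈ S.init ∧ ∀ i, (r i, r (i + 1)) ∈ S.E

def TS.Beh (S : TS X) : Set (ℕ → ℚ) :=
  {b | ∃ r : ℕ → X, S.IsRun r ∧ b = fun i => S.H (r i)}

noncomputable def LimAvg (v : ℕ → ℚ) : ℝ :=
  Filter.atTop.liminf fun n => (∑ i ∈ Finset.range (n + 1), (v i : ℝ)) / (n + 1)

noncomputable def TS.VS (S : TS X) : ℝ := sInf (LimAvg '' S.Beh)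

/-- Length-`l` contiguous subwords (infixes) of behaviors of `S`: the state set
`X_l` of the strongest `l`-complete abstraction. -/
def TS.Infixes (S : TS X) (l : ℕ) : Set (Fin l → ℚ) :=
  {w | ∃ b ∈ S.Beh, ∃ j : ℕ, ∀ i : Fin l, w i = b (j + i)}

/-- Length-`l` prefixes of behaviors of `S` (the set `B^l(S)`). -/
def TS.Prefixes (S : TS X) (l : ℕ) : Set (Fin l → ℚ) :=
  {w | ∃ b ∈ S.Beh, ∀ i : Fin l, w i = b i}

/-- The domino rule: the first `l-1` letters of `w'` are the last `l-1`
letters of `w`. -/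
def domino {l : ℕ} (w w' : Fin l → ℚ) : Prop :=
  ∀ i : ℕ, (h : i + 1 < l) → w' ⟨i, Nat.lt_of_succ_lt h⟩ = w ⟨i + 1, h⟩

/-- The strongest `l`-complete abstraction of `S`: states are the length-`l`
infixes of behaviors, initial states the length-`l` prefixes, transitions by
the domino rule, and the output of a word is its first letter. -/
def TS.SlCA (S : TS X) (l : ℕ) (hl : 0 < l) : TS (Fin l → ℚ) where
  init := S.Prefixes l
  E := {p | p.1 ∈ S.Infixes l ∧ p.2 ∈ S.Infixes l ∧ domino p.1 p.2}
  H := fun w => w ⟨0, hl⟩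


def occursAt (b : ℕ → ℚ) {m : ℕ} (β : Fin m → ℚ) (j : ℕ) : Prop :=
  ∀ i : Fin m, b (j + i) = β i

def TS.Transient (S : TS X) {m : ℕ} (β : Fin m → ℚ) : Prop :=
  ∃ L : ℕ, ∀ b ∈ S.Beh, ∀ j : ℕ, occursAt b β j → j ≤ L

noncomputable def Avg {m : ℕ} (β : Fin m → ℚ) : ℝ :=
  (∑ i, (β i : ℝ)) / m

/-- The infinite periodic repetition `σ^ω` of a finite word `σ` of positive
length `m`. -/
def perWord {m : ℕ} (hm : 0 < m) (σ : Fin m → ℚ) : ℕ → ℚ :=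
  fun i => σ ⟨i % m, Nat.mod_lt _ hm⟩

/-- `τ` is a cyclic permutation of `σ`. -/
def IsCyclicPerm {m : ℕ} (hm : 0 < m) (σ τ : Fin m → ℚ) : Prop :=
  ∃ i0 : ℕ, ∀ j : Fin m, τ j = σ ⟨((j : ℕ) + i0) % m, Nat.mod_lt _ hm⟩

/-- A cycle `x_0 … x_p` of a transition system. -/
def TS.IsCycle (S : TS X) {p : ℕ} (x : Fin (p + 1) → X) : Prop :=
  (∀ i : Fin p, (x i.castSucc, x i.succ) ∈ S.E) ∧ (x (Fin.last p), x 0) ∈ S.E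

/-- The sum of the length-`m` window of `v` starting at position `j`. -/
def windowSum (v : ℕ → ℚ) (m j : ℕ) : ℝ := ∑ i ∈ Finset.range m, (v (j + i) : ℝ)

lemma avg_window (v : ℕ → ℚ) (m j : ℕ) :
    Avg (fun i : Fin m => v (j + i)) = windowSum v m j / m := by
  rw [Avg, windowSum, Finset.sum_range]

lemma windowSum_succ (v : ℕ → ℚ) (m j : ℕ) :
    windowSum v m (j + 1) = windowSum v m j + v (j + m) - v j := by
  have h : windowSum v m j + v (j + m) = windowSum v m (j + 1) + v j := by
    unfold windowSum
    rw [← Finset.sum_range_succ (fun i => (v (j + i) : ℝ)), Finset.sum_range_succ']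
    simp [add_assoc, add_comm 1]
  linarith

lemma windowSum_const_of_periodic {v : ℕ → ℚ} {q : ℕ} (hv : Function.Periodic v q) (j : ℕ) :
    windowSum v q j = windowSum v q 0 := by
  induction j with
  | zero => rfl
  | succ j ih => rw [windowSum_succ, hv j, ih]; ring

lemma sum_windowSum_of_periodic {v : ℕ → ℚ} {q : ℕ} (hv : Function.Periodic v q) (m j₀ : ℕ) :
    ∑ j ∈ Finset.range q, windowSum v m (j₀ + j) = m * windowSum v q 0 := by
  unfold windowSum
  rw [Finset.sum_comm]
  have h : ∀ i ∈ Finset.range m, ∑ j ∈ Finset.range q, (v (j₀ + j + i) : ℝ)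
      = windowSum v q 0 := by
    intro i _
    rw [← windowSum_const_of_periodic hv (j₀ + i), windowSum]
    exact Finset.sum_congr rfl fun j _ => by rw [add_right_comm]
  rw [Finset.sum_congr rfl h]
  simp [windowSum]

lemma sum_range_lower_bound {u : ℕ → ℝ} {C : ℝ} (hC : ∀ i, -C ≤ u i) (hC0 : 0 ≤ C)
    {m N : ℕ} (hm : 0 < m)
    (h : ∀ j ≥ N, 0 ≤ ∑ i ∈ Finset.range m, u (j + i)) (n : ℕ) :
    -(C * (N + m)) ≤ ∑ i ∈ Finset.range n, u i := by
  induction n using Nat.strong_induction_on with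
  | _ n ih =>
    by_cases hn : n < N + m
    · have h1 : ∑ _i ∈ Finset.range n, (-C) ≤ ∑ i ∈ Finset.range n, u i :=
        Finset.sum_le_sum fun i _ => hC i
      have h2 : (n : ℝ) ≤ N + m := by exact_mod_cast hn.le
      simp only [Finset.sum_const, Finset.card_range, nsmul_eq_mul] at h1
      nlinarith
    · obtain ⟨k, rfl⟩ : ∃ k, n = k + m := ⟨n - m, by omega⟩
      rw [Finset.sum_range_add]
      linarith [ih k (by omega), h k (by omega)]

lemma exists_average_lower_bound {u : ℕ → ℝ} {C c : ℝ} (hC : ∀ i, |u i| ≤ C)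
    {m N : ℕ} (hm : 0 < m)
    (h : ∀ j ≥ N, m * c ≤ ∑ i ∈ Finset.range m, u (j + i)) :
    ∃ K : ℝ, ∀ n : ℕ,
      c - K / (n + 1) ≤ (∑ i ∈ Finset.range (n + 1), u i) / (n + 1) := by
  refine ⟨(C + |c|) * (N + m), fun n => ?_⟩
  have hb := sum_range_lower_bound (u := fun i => u i - c) (C := C + |c|) (N := N)
    (fun i => by linarith [neg_abs_le (u i), hC i, le_abs_self c])
    (by linarith [abs_nonneg (u 0), hC 0, abs_nonneg c]) hm
    (fun j hj => by
      have := h j hj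
      simp only [Finset.sum_sub_distrib, Finset.sum_const, Finset.card_range, nsmul_eq_mul]
      linarith) (n + 1)
  simp only [Finset.sum_sub_distrib, Finset.sum_const, Finset.card_range, nsmul_eq_mul] at hb
  push_cast at hb
  have hn : (0 : ℝ) < n + 1 := by positivity
  rw [le_div_iff₀ hn, sub_mul, div_mul_cancel₀ _ hn.ne']
  linarith

lemma tendsto_sub_div_succ (c K : ℝ) :
    Filter.Tendsto (fun n : ℕ => c - K / (n + 1)) Filter.atTop (nhds c) := by
  have h := (tendsto_one_div_add_atTop_nhds_zero_nat (𝕜 := ℝ)).const_mul K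
  simpa [div_eq_mul_inv] using h.const_sub c

lemma abs_average_le {u : ℕ → ℝ} {C : ℝ} (hC : ∀ i, |u i| ≤ C) (n : ℕ) :
    |(∑ i ∈ Finset.range (n + 1), u i) / (n + 1)| ≤ C := by
  have hn : (0 : ℝ) < n + 1 := by positivity
  rw [abs_div, abs_of_pos hn, div_le_iff₀ hn]
  calc |∑ i ∈ Finset.range (n + 1), u i| ≤ ∑ i ∈ Finset.range (n + 1), |u i| :=
        Finset.abs_sum_le_sum_abs _ _
    _ ≤ ∑ _i ∈ Finset.range (n + 1), C := Finset.sum_le_sum fun i _ => hC i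
    _ = C * (n + 1) := by simp [mul_comm]

lemma le_limAvg {v : ℕ → ℚ} {C c : ℝ} (hC : ∀ i, |(v i : ℝ)| ≤ C) {m N : ℕ} (hm : 0 < m)
    (h : ∀ j ≥ N, m * c ≤ windowSum v m j) : c ≤ LimAvg v := by
  obtain ⟨K, hK⟩ := exists_average_lower_bound hC hm h
  rw [LimAvg, ← (tendsto_sub_div_succ c K).liminf_eq]
  refine Filter.liminf_le_liminf (Filter.Eventually.of_forall hK)
    (tendsto_sub_div_succ c K).isBoundedUnder_ge ?_
  exact Filter.IsBoundedUnder.isCoboundedUnder_ge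
    ⟨C, Filter.eventually_map.2 (Filter.Eventually.of_forall fun n =>
      (le_abs_self _).trans (abs_average_le hC n))⟩

lemma limAvg_of_periodic {v : ℕ → ℚ} {q : ℕ} (hq : 0 < q) (hv : Function.Periodic v q) :
    LimAvg v = windowSum v q 0 / q := by
  obtain ⟨C, hC⟩ : ∃ C : ℝ, ∀ i, |(v i : ℝ)| ≤ C := by
    refine ⟨∑ i ∈ Finset.range q, |(v i : ℝ)|, fun i => ?_⟩
    rw [← hv.map_mod_nat i]
    exact Finset.single_le_sum (f := fun i => |(v i : ℝ)|) (fun _ _ => abs_nonneg _)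
      (Finset.mem_range.2 (Nat.mod_lt i hq))
  have hq' : (q : ℝ) ≠ 0 := by positivity
  have hw : ∀ j, ∑ i ∈ Finset.range q, (v (j + i) : ℝ) = windowSum v q 0 := fun j =>
    windowSum_const_of_periodic hv j
  obtain ⟨K, hK⟩ := exists_average_lower_bound (c := windowSum v q 0 / q) (N := 0) hC hq
    (fun j _ => by rw [hw, mul_div_cancel₀ _ hq'])
  obtain ⟨K', hK'⟩ := exists_average_lower_bound (u := fun i => -(v i : ℝ))
    (c := -(windowSum v q 0 / q)) (N := 0) (C := C) (fun i => by rw [abs_neg]; exact hC i) hq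
    (fun j _ => by rw [Finset.sum_neg_distrib, hw, mul_neg, mul_div_cancel₀ _ hq'])
  refine Filter.Tendsto.liminf_eq (tendsto_of_tendsto_of_tendsto_of_le_of_le
    (tendsto_sub_div_succ _ K) (tendsto_sub_div_succ _ (-K')) hK fun n => ?_)
  have := hK' n
  rw [Finset.sum_neg_distrib, neg_div] at this
  simp only [neg_div]
  linarith

lemma perWord_periodic {m : ℕ} (hm : 0 < m) (σ : Fin m → ℚ) :
    Function.Periodic (perWord hm σ) m := fun i => by simp [perWord]

lemma limAvg_perWord {m : ℕ} (hm : 0 < m) (σ : Fin m → ℚ) :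
    LimAvg (perWord hm σ) = Avg σ := by
  rw [limAvg_of_periodic hm (perWord_periodic hm σ), ← avg_window]
  congr 1
  ext i
  simp [perWord, Nat.mod_eq_of_lt i.isLt]

/-- `β` is a non-transient infix of some behavior of `S`. -/
def TS.IsNontransientInfix (S : TS X) {m : ℕ} (β : Fin m → ℚ) : Prop :=
  ∃ α ∈ S.Beh, ∃ j : ℕ, β = (fun i : Fin m => α (j + i)) ∧ ¬ S.Transient β

lemma TS.beh_mem {S : TS X} {Y : Finset ℚ} (hY : ∀ x, S.H x ∈ Y) {b : ℕ → ℚ}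
    (hb : b ∈ S.Beh) (i : ℕ) : b i ∈ Y := by
  obtain ⟨r, _, rfl⟩ := hb
  exact hY _

/-- Transient words of a fixed length occur only in a uniformly bounded initial segment. -/
lemma TS.exists_transient_bound {S : TS X} {Y : Finset ℚ} (hY : ∀ x, S.H x ∈ Y) (m : ℕ) :
    ∃ L : ℕ, ∀ b ∈ S.Beh, ∀ j > L, S.IsNontransientInfix (fun i : Fin m => b (j + i)) := by
  have h : ∀ β : Fin m → ℚ, ∃ L : ℕ, S.Transient β →
      ∀ b ∈ S.Beh, ∀ j : ℕ, occursAt b β j → j ≤ L := by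
    intro β
    by_cases hβ : S.Transient β
    · exact hβ.imp fun L hL _ => hL
    · exact ⟨0, fun h => absurd h hβ⟩
  choose f hf using h
  refine ⟨(Fintype.piFinset fun _ => Y).sup f, fun b hb j hj => ⟨b, hb, j, rfl, fun ht => ?_⟩⟩
  have h1 := hf _ ht b hb j fun i => rfl
  have h2 : f (fun i : Fin m => b (j + i)) ≤ (Fintype.piFinset fun _ => Y).sup f :=
    Finset.le_sup (Fintype.mem_piFinset.2 fun i => TS.beh_mem hY hb _)
  omega

lemma TS.finite_nontransientInfix {S : TS X} {Y : Finset ℚ} (hY : ∀ x, S.H x ∈ Y) (m : ℕ) :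
    {β : Fin m → ℚ | S.IsNontransientInfix β}.Finite := by
  refine (Fintype.piFinset fun _ : Fin m => Y).finite_toSet.subset ?_
  rintro β ⟨α, hα, j, rfl, -⟩
  exact Finset.mem_coe.2 (Fintype.mem_piFinset.2 fun i => TS.beh_mem hY hα _)

lemma TS.SlCA_state_eq {S : TS X} {l : ℕ} (hl : 0 < l) {r : ℕ → Fin l → ℚ}
    (hr : ∀ i, (r i, r (i + 1)) ∈ (S.SlCA l hl).E) :
    ∀ (k : ℕ) (hk : k < l) (i : ℕ), r i ⟨k, hk⟩ = (S.SlCA l hl).H (r (i + k))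
  | 0, _, _ => rfl
  | k + 1, hk, i => by
    have h : r (i + 1) ⟨k, _⟩ = r i ⟨k + 1, hk⟩ := (hr i).2.2 k hk
    rw [← h, TS.SlCA_state_eq hl hr k _ (i + 1), add_right_comm, add_assoc]

lemma TS.SlCA_window {S : TS X} {m L : ℕ}
    (hL : ∀ b ∈ S.Beh, ∀ j > L, S.IsNontransientInfix (fun i : Fin m => b (j + i)))
    (hl : 0 < L + 1 + m) {r : ℕ → Fin (L + 1 + m) → ℚ}
    (hr : ∀ i, (r i, r (i + 1)) ∈ (S.SlCA (L + 1 + m) hl).E) {j : ℕ} (hj : L + 1 ≤ j) :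
    S.IsNontransientInfix
      (fun i : Fin m => (S.SlCA (L + 1 + m) hl).H (r (j + i))) := by
  obtain ⟨k, rfl⟩ := Nat.exists_eq_add_of_le' hj
  obtain ⟨b, hb, n, hn⟩ := (hr k).1
  convert hL b hb (n + (L + 1)) (by omega) using 2 with i
  have h : r k ⟨L + 1 + i, _⟩ = b (n + (L + 1 + i)) := hn ⟨L + 1 + i, by omega⟩
  rw [TS.SlCA_state_eq hl hr] at h
  rw [add_assoc n, ← h, add_assoc k]

lemma TS.beh_subset_SlCA (S : TS X) {l : ℕ} (hl : 0 < l) : S.Beh ⊆ (S.SlCA l hl).Beh := by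
  intro b hb
  refine ⟨fun i k => b (i + k), ⟨⟨b, hb, fun i => by simp⟩, fun i => ?_⟩, ?_⟩
  · refine ⟨⟨b, hb, i, fun _ => rfl⟩, ⟨b, hb, i + 1, fun _ => rfl⟩, fun k hk => ?_⟩
    change b (i + 1 + k) = b (i + (k + 1))
    congr 1
    omega
  · ext i
    simp [TS.SlCA]

lemma TS.IsCycle.transition {Z : Type*} {T : TS Z} {p : ℕ} {x : Fin (p + 1) → Z}
    (hx : T.IsCycle x) (i : ℕ) :
    (x ⟨i % (p + 1), Nat.mod_lt _ p.succ_pos⟩,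
      x ⟨(i + 1) % (p + 1), Nat.mod_lt _ p.succ_pos⟩) ∈ T.E := by
  have hlt := Nat.mod_lt i p.succ_pos
  rcases Nat.lt_succ_iff_lt_or_eq.1 hlt with h | h
  · convert hx.1 ⟨i % (p + 1), h⟩ using 3
    · rfl
    · refine Fin.ext ?_
      change (i + 1) % (p + 1) = i % (p + 1) + 1
      rw [← Nat.mod_add_mod, Nat.mod_eq_of_lt (Nat.succ_lt_succ h)]
  · convert hx.2 using 3
    · exact Fin.ext h
    · refine Fin.ext ?_
      change (i + 1) % (p + 1) = 0
      rw [← Nat.mod_add_mod, h, Nat.mod_self]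

/-- under the hypotheses of Statement 4 plus the existence of a
length-`m` word `σ` with `σ^ω ∈ B^ω(S)` such that every non-transient
length-`m` infix `β` of a behavior that is not an infix of `σ^ω` satisfies
`LimAvg(β^ω) > VS(S)`, there is a finite `l` with `VS(S_l) = VS(S) =
LimAvg(σ^ω)` and every smallest-in-average cycle of `S_l` has output word
whose infinite repetition equals `τ^ω` for some cyclic permutation `τ` of `σ`. -/
theorem stmt5 (Y : Finset ℚ) (S : TS X) (hY : ∀ x, S.H x ∈ Y)
    (hne : S.Beh.Nonempty) (m : ℕ) (hm0 : 0 < m)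
    (h1 : ∀ α ∈ S.Beh, ∀ j : ℕ,
      ¬ S.Transient (fun i : Fin m => α (j + i)) →
      Avg (fun i : Fin m => α (j + i)) ≥ S.VS)
    (σ : Fin m → ℚ) (hσ : perWord hm0 σ ∈ S.Beh)
    (h2 : ∀ α ∈ S.Beh, ∀ j : ℕ,
      ¬ S.Transient (fun i : Fin m => α (j + i)) →
      ¬ (∃ j' : ℕ, occursAt (perWord hm0 σ) (fun i : Fin m => α (j + i)) j') →
      LimAvg (perWord hm0 (fun i : Fin m => α (j + i))) > S.VS) :
    ∃ l : ℕ, ∃ hl : 0 < l,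
      (S.SlCA l hl).VS = S.VS ∧ S.VS = LimAvg (perWord hm0 σ) ∧
      ∀ (p : ℕ) (x : Fin (p + 1) → (Fin l → ℚ)),
        (S.SlCA l hl).IsCycle x →
        LimAvg (perWord (Nat.succ_pos p) (fun i => (S.SlCA l hl).H (x i)))
          = (S.SlCA l hl).VS →
        ∃ τ : Fin m → ℚ, IsCyclicPerm hm0 σ τ ∧
          perWord (Nat.succ_pos p) (fun i => (S.SlCA l hl).H (x i))
            = perWord hm0 τ := by
  have hm' : (0 : ℝ) < m := by exact_mod_cast hm0
  obtain ⟨C, hC⟩ : ∃ C : ℝ, ∀ y ∈ Y, |(y : ℝ)| ≤ C :=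
    ⟨∑ y ∈ Y, |(y : ℝ)|, fun y hy =>
      Finset.single_le_sum (f := fun y : ℚ => |(y : ℝ)|) (fun _ _ => abs_nonneg _) hy⟩
  obtain ⟨L, hL⟩ := TS.exists_transient_bound hY m
  have hlow : ∀ b : ℕ → ℚ, (∀ i, b i ∈ Y) → ∀ c : ℝ,
      (∀ j > L, c ≤ Avg (fun i : Fin m => b (j + i))) → c ≤ LimAvg b := by
    intro b hb c h
    refine le_limAvg (C := C) (fun i => hC _ (hb i)) (N := L + 1) hm0 fun j hj => ?_
    have := h j hj
    rw [avg_window, le_div_iff₀ hm'] at this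
    linarith
  have hge : ∀ β : Fin m → ℚ, S.IsNontransientInfix β → S.VS ≤ Avg β := by
    rintro β ⟨α, hα, j, rfl, ht⟩
    exact h1 α hα j ht
  have hgt : ∀ β : Fin m → ℚ, S.IsNontransientInfix β →
      (¬ ∃ j', occursAt (perWord hm0 σ) β j') → S.VS < Avg β := by
    rintro β ⟨α, hα, j, rfl, ht⟩ hno
    rw [← limAvg_perWord hm0]
    exact h2 α hα j ht hno
  have hbelow : ∀ b ∈ S.Beh, S.VS ≤ LimAvg b := fun b hb =>
    hlow b (TS.beh_mem hY hb) _ fun j hj => hge _ (hL b hb j hj)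
  have hval : S.VS = LimAvg (perWord hm0 σ) := by
    refine (hbelow _ hσ).antisymm (not_lt.1 fun hlt => ?_)
    have hall : ∀ β : Fin m → ℚ, S.IsNontransientInfix β → S.VS < Avg β := by
      intro β hβ
      by_cases ho : ∃ j', occursAt (perWord hm0 σ) β j'
      · obtain ⟨j', hj'⟩ := ho
        have hp := perWord_periodic hm0 σ
        rwa [show β = fun i : Fin m => perWord hm0 σ (j' + i) from funext fun i => (hj' i).symm,
          avg_window, windowSum_const_of_periodic hp, ← limAvg_of_periodic hm0 hp]
      · exact hgt β hβ ho
    obtain ⟨b, hb⟩ := hne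
    obtain ⟨β, hβ, hmin⟩ := Set.exists_min_image _ Avg (TS.finite_nontransientInfix hY m)
      ⟨_, hL b hb (L + 1) (Nat.lt_succ_self L)⟩
    have : Avg β ≤ S.VS := by
      refine le_csInf ⟨_, b, hb, rfl⟩ ?_
      rintro _ ⟨a, ha, rfl⟩
      exact hlow a (TS.beh_mem hY ha) _ fun j hj => hmin _ (hL a ha j hj)
    exact absurd (hall β hβ) this.not_gt
  have hl : 0 < L + 1 + m := by omega
  have hbelow' : ∀ b ∈ (S.SlCA (L + 1 + m) hl).Beh, S.VS ≤ LimAvg b := by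
    rintro _ ⟨r, hr, rfl⟩
    refine hlow _ (fun i => ?_) _ fun j hj => hge _ (TS.SlCA_window hL hl hr.2 hj)
    obtain ⟨b, hb, n, hn⟩ := (hr.2 i).1
    have h : (S.SlCA (L + 1 + m) hl).H (r i) = b (n + 0) := hn ⟨0, hl⟩
    exact h ▸ TS.beh_mem hY hb _
  have hVS : (S.SlCA (L + 1 + m) hl).VS = S.VS := by
    have hmem := S.beh_subset_SlCA hl hσ
    refine le_antisymm ?_ (le_csInf ⟨_, _, hmem, rfl⟩ ?_)
    · rw [hval]
      refine csInf_le ⟨S.VS, ?_⟩ ⟨_, hmem, rfl⟩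
      rintro _ ⟨b, hb, rfl⟩
      exact hbelow' b hb
    · rintro _ ⟨b, hb, rfl⟩
      exact hbelow' b hb
  refine ⟨L + 1 + m, hl, hVS, hval, fun p x hx hmin => ?_⟩
  rw [hVS] at hmin
  set v := perWord (Nat.succ_pos p) (fun i => (S.SlCA (L + 1 + m) hl).H (x i)) with hv
  have hper : Function.Periodic v (p + 1) := perWord_periodic _ _
  have hgood : ∀ j, S.IsNontransientInfix (fun i : Fin m => v (j + i)) := by
    intro j
    have h := TS.SlCA_window hL hl (r := fun i => x ⟨i % (p + 1), Nat.mod_lt _ p.succ_pos⟩)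
      hx.transition (j := j + (L + 1) * (p + 1)) (by nlinarith)
    convert h using 2 with i
    change v (j + i) = v (j + (L + 1) * (p + 1) + i)
    exact add_right_comm j i _ ▸ ((hper.nsmul (L + 1)) (j + i)).symm
  have hwge : ∀ j, 0 ≤ windowSum v m j - m * S.VS := by
    intro j
    have h := hge _ (hgood j)
    rw [avg_window, le_div_iff₀ hm'] at h
    linarith
  have hw : ∀ j, windowSum v m j = m * S.VS := by
    intro j
    have hsum : ∑ k ∈ Finset.range (p + 1), (windowSum v m (j + k) - m * S.VS) = 0 := by
      rw [limAvg_of_periodic p.succ_pos hper] at hmin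
      rw [Finset.sum_sub_distrib, sum_windowSum_of_periodic hper, ← hmin]
      simp
      field_simp
      ring
    have h := (Finset.sum_eq_zero_iff_of_nonneg fun k _ => hwge (j + k)).1 hsum 0 (by simp)
    rw [add_zero] at h
    linarith
  have hperm : Function.Periodic v m := by
    intro j
    have h := windowSum_succ v m j
    rw [hw, hw] at h
    have h' : (v (j + m) : ℝ) = v j := by linarith
    exact_mod_cast h'
  obtain ⟨i₀, hi₀⟩ : ∃ j', occursAt (perWord hm0 σ) (fun i : Fin m => v (0 + i)) j' := by
    by_contra hno
    have h := hgt _ (hgood 0) hno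
    rw [avg_window, hw, mul_div_cancel_left₀ _ hm'.ne'] at h
    exact lt_irrefl _ h
  refine ⟨fun i : Fin m => v (0 + i), ⟨i₀, fun j => ?_⟩, ?_⟩
  · rw [← hi₀ j, perWord]
    simp only [add_comm]
  · ext n
    change v n = v (0 + n % m)
    rw [zero_add, hperm.map_mod_nat]
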